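/- For every integer n ≥ 3, every optimal set α of n-means for the condensation measure P satisfies α ∩ [0, 1/5] ≠ ∅, α ∩ [4/5, 1] ≠ ∅, and α ∩ [2/5, 3/5] ≠ ∅. -/

import Mathlib

open MeasureTheory Metric Set Filter

/-- The distortion error of a set `α` of quantizer points for `μ`, of order 2:
`∫ min_{a ∈ α} (x - a)^2 dμ(x)`. -/
noncomputable def distortion (μ : MeasureTheory.Measure ℝ) (α : Set ℝ) : ℝ :=
  ∫ x, (Metric.infDist x α) ^ 2 ∂μ

/-- The `n`th quantization error of order 2 for `μ`. -/
noncomputable def quantErr (μ : MeasureTheory.Measure ℝ) (n : ℕ) : ℝ :=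
  sInf {e : ℝ | ∃ α : Set ℝ, α.Finite ∧ α.Nonempty ∧ α.ncard ≤ n ∧ e = distortion μ α}

/-- `α` is an optimal set of `n`-means for `μ`. -/
def IsOptimalSet (μ : MeasureTheory.Measure ℝ) (n : ℕ) (α : Set ℝ) : Prop :=
  α.Finite ∧ α.Nonempty ∧ α.ncard ≤ n ∧ distortion μ α = quantErr μ n

/-- The similarity `S₁(x) = x/5`. -/
noncomputable def S1 : ℝ → ℝ := fun x => x / 5

/-- The similarity `S₂(x) = x/5 + 4/5`. -/
noncomputable def S2 : ℝ → ℝ := fun x => x / 5 + 4 / 5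

/-- `P` is the condensation measure associated with `(S₁, S₂; 1/3, 1/3, 1/3; ν)`:
`P = (1/3) P∘S₁⁻¹ + (1/3) P∘S₂⁻¹ + (1/3) ν`. -/
def IsCondensation (P ν : MeasureTheory.Measure ℝ) : Prop :=
  MeasureTheory.IsProbabilityMeasure P ∧
    P = (1 / 3 : ENNReal) • P.map S1 + (1 / 3 : ENNReal) • P.map S2 + (1 / 3 : ENNReal) • ν

/-- The point `a_{j+1} = 3/5 - 1/(5 · 2^j)` (so `aseq 0 = a₁ = 2/5`). -/
noncomputable def aseq (j : ℕ) : ℝ := 3 / 5 - 1 / (5 * 2 ^ j)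

/-- The infinite discrete distribution `ν = ∑_{j ≥ 1} 2^{-j} δ_{a_j}`. -/
noncomputable def nuDisc : MeasureTheory.Measure ℝ :=
  MeasureTheory.Measure.sum
    (fun j : ℕ => ((1 / 2 : ENNReal) ^ (j + 1)) • MeasureTheory.Measure.dirac (aseq j))

lemma measurable_S1 : Measurable S1 := by unfold S1; fun_prop

lemma measurable_S2 : Measurable S2 := by unfold S2; fun_prop

lemma aseq_mem (j : ℕ) : aseq j ∈ Icc (2 / 5 : ℝ) (3 / 5) := by
  have h : (1 : ℝ) / (5 * 2 ^ j) ≤ 1 / 5 := by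
    apply one_div_le_one_div_of_le (by norm_num)
    nlinarith [one_le_pow₀ (n := j) (one_le_two (α := ℝ))]
  have h' : (0 : ℝ) < 1 / (5 * 2 ^ j) := by positivity
  unfold aseq
  constructor <;> linarith

lemma ae_nuDisc {p : ℝ → Prop} (h : ∀ j, p (aseq j)) : ∀ᵐ x ∂nuDisc, p x := by
  unfold nuDisc
  refine Measure.ae_sum_iff.2 fun j => Measure.ae_smul_measure ?_ _
  rw [ae_dirac_eq]
  exact h j

lemma hasSum_integral_nuDisc {f : ℝ → ℝ} (hf : Integrable f nuDisc) :
    HasSum (fun j : ℕ => (1 / 2 : ℝ) ^ (j + 1) * f (aseq j)) (∫ x, f x ∂nuDisc) := by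
  unfold nuDisc at *
  simpa [integral_smul_measure] using hasSum_integral_measure hf

lemma le_integral_nuDisc {f : ℝ → ℝ} (hf : Integrable f nuDisc) (h0 : ∀ j, 0 ≤ f (aseq j)) :
    1 / 2 * f (2 / 5) + 1 / 4 * f (1 / 2) + 1 / 8 * f (11 / 20) + 1 / 16 * f (23 / 40)
      ≤ ∫ x, f x ∂nuDisc := by
  have h := sum_le_hasSum (Finset.range 4)
    (fun j _ => mul_nonneg (by positivity) (h0 j)) (hasSum_integral_nuDisc hf)
  have e0 : aseq 0 = 2 / 5 := by norm_num [aseq]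
  have e1 : aseq 1 = 1 / 2 := by norm_num [aseq]
  have e2 : aseq 2 = 11 / 20 := by norm_num [aseq]
  have e3 : aseq 3 = 23 / 40 := by norm_num [aseq]
  simp only [Finset.sum_range_succ, Finset.sum_range_zero, e0, e1, e2, e3] at h
  norm_num at h ⊢
  linarith

lemma hasSum_mul_geometric {r : ℝ} (h0 : 0 ≤ r) (h1 : r < 1) (c : ℝ) :
    HasSum (fun j : ℕ => c * r ^ j) (c * (1 - r)⁻¹) :=
  (hasSum_geometric_of_lt_one h0 h1).mul_left c

lemma integral_id_nuDisc (hf : Integrable (fun x : ℝ => x) nuDisc) :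
    ∫ x, x ∂nuDisc = 7 / 15 := by
  refine (hasSum_integral_nuDisc hf).unique ?_
  have h := (hasSum_mul_geometric (r := 1 / 2) (by norm_num) (by norm_num) (3 / 10)).sub
    (hasSum_mul_geometric (r := 1 / 4) (by norm_num) (by norm_num) (1 / 10))
  have e : (fun j : ℕ => (1 / 2 : ℝ) ^ (j + 1) * aseq j) =
      fun j => 3 / 10 * (1 / 2) ^ j - 1 / 10 * (1 / 4) ^ j := by
    funext j
    have : (1 / 4 : ℝ) ^ j = (1 / 2) ^ j * (1 / 2) ^ j := by rw [← mul_pow]; norm_num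
    rw [this]
    simp only [aseq, one_div, mul_inv, inv_pow, pow_succ]
    ring
  rw [e, show (7 / 15 : ℝ) = 3 / 10 * (1 - 1 / 2)⁻¹ - 1 / 10 * (1 - 1 / 4)⁻¹ by norm_num]
  exact h

lemma integral_sq_nuDisc (hf : Integrable (fun x : ℝ => x ^ 2) nuDisc) :
    ∫ x, x ^ 2 ∂nuDisc = 8 / 1575 + (7 / 15) ^ 2 := by
  refine (hasSum_integral_nuDisc hf).unique ?_
  have h := ((hasSum_mul_geometric (r := 1 / 2) (by norm_num) (by norm_num) (9 / 50)).sub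
    (hasSum_mul_geometric (r := 1 / 4) (by norm_num) (by norm_num) (3 / 25))).add
    (hasSum_mul_geometric (r := 1 / 8) (by norm_num) (by norm_num) (1 / 50))
  have e : (fun j : ℕ => (1 / 2 : ℝ) ^ (j + 1) * aseq j ^ 2) =
      fun j => 9 / 50 * (1 / 2) ^ j - 3 / 25 * (1 / 4) ^ j + 1 / 50 * (1 / 8) ^ j := by
    funext j
    have h4 : (1 / 4 : ℝ) ^ j = (1 / 2) ^ j * (1 / 2) ^ j := by rw [← mul_pow]; norm_num
    have h8 : (1 / 8 : ℝ) ^ j = (1 / 2) ^ j * (1 / 2) ^ j * (1 / 2) ^ j := by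
      rw [← mul_pow, ← mul_pow]; norm_num
    rw [h4, h8]
    simp only [aseq, one_div, mul_inv, inv_pow, pow_succ]
    ring
  rw [e, show (8 / 1575 + (7 / 15) ^ 2 : ℝ) =
    9 / 50 * (1 - 1 / 2)⁻¹ - 3 / 25 * (1 - 1 / 4)⁻¹ + 1 / 50 * (1 - 1 / 8)⁻¹ by norm_num]
  exact h

section Condensation

variable {P : Measure ℝ}

lemma IsCondensation.ae_mem (hP : IsCondensation P nuDisc) :
    ∀ᵐ x ∂P, x ∈ Icc (0 : ℝ) 1 := by
  have := hP.1
  have hν : nuDisc (Icc (0 : ℝ) 1)ᶜ = 0 :=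
    ae_nuDisc (p := fun x => x ∈ Icc (0 : ℝ) 1) fun j =>
      Icc_subset_Icc (by norm_num) (by norm_num) (aseq_mem j)
  have hm : MeasurableSet (Icc (0 : ℝ) 1)ᶜ := measurableSet_Icc.compl
  have h1 : P (S1 ⁻¹' (Icc (0 : ℝ) 1)ᶜ) ≤ P (Icc (0 : ℝ) 1)ᶜ := by
    refine measure_mono fun x hx hx' => hx ?_
    simp only [S1, mem_Icc] at *
    constructor <;> linarith
  have h2 : P (S2 ⁻¹' (Icc (0 : ℝ) 1)ᶜ) ≤ P (Icc (0 : ℝ) 1)ᶜ := by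
    refine measure_mono fun x hx hx' => hx ?_
    simp only [S2, mem_Icc] at *
    constructor <;> linarith
  have h := congrArg (fun μ : Measure ℝ => μ (Icc (0 : ℝ) 1)ᶜ) hP.2
  simp only [Measure.add_apply, Measure.smul_apply, hν,
    Measure.map_apply measurable_S1 hm, Measure.map_apply measurable_S2 hm, smul_eq_mul, mul_zero, add_zero] at h
  change P (Icc (0 : ℝ) 1)ᶜ = 0
  have hr := congrArg ENNReal.toReal h
  rw [ENNReal.toReal_add (by finiteness) (by finiteness), ENNReal.toReal_mul,
    ENNReal.toReal_mul] at hr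
  have h1' := ENNReal.toReal_mono (by finiteness) h1
  have h2' := ENNReal.toReal_mono (by finiteness) h2
  simp only [ENNReal.toReal_div, ENNReal.toReal_one, ENNReal.toReal_ofNat] at hr
  have h0 := ENNReal.toReal_nonneg (a := P (Icc (0 : ℝ) 1)ᶜ)
  have : (P (Icc (0 : ℝ) 1)ᶜ).toReal = 0 := by linarith
  exact (ENNReal.toReal_eq_zero_iff _).1 this |>.resolve_right (by finiteness)

lemma IsCondensation.integrable (hP : IsCondensation P nuDisc) {f : ℝ → ℝ}
    (hf : Continuous f) : Integrable f P := by
  have := hP.1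
  rw [← Measure.restrict_eq_self_of_ae_mem hP.ae_mem]
  exact hf.continuousOn.integrableOn_compact isCompact_Icc

lemma IsCondensation.third_map_S1_le (hP : IsCondensation P nuDisc) :
    (1 / 3 : ENNReal) • P.map S1 ≤ P := by
  conv_rhs => rw [hP.2, add_assoc]
  exact Measure.le_add_right le_rfl

lemma IsCondensation.third_map_S2_le (hP : IsCondensation P nuDisc) :
    (1 / 3 : ENNReal) • P.map S2 ≤ P := by
  conv_rhs => rw [hP.2, add_assoc]
  exact Measure.le_add_left (Measure.le_add_right le_rfl)

lemma IsCondensation.third_nuDisc_le (hP : IsCondensation P nuDisc) :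
    (1 / 3 : ENNReal) • nuDisc ≤ P := by
  conv_rhs => rw [hP.2]
  exact Measure.le_add_left le_rfl

lemma integrable_of_third_smul {μ ρ : Measure ℝ} {f : ℝ → ℝ}
    (hle : (1 / 3 : ENNReal) • μ ≤ ρ) (hf : Integrable f ρ) : Integrable f μ :=
  (integrable_smul_measure (by simp) (by simp)).1 (hf.mono_measure hle)

lemma IsCondensation.integrable_comp_S1 (hP : IsCondensation P nuDisc) {f : ℝ → ℝ}
    (hf : Integrable f P) : Integrable (fun x => f (S1 x)) P :=
  (integrable_of_third_smul hP.third_map_S1_le hf).comp_measurable measurable_S1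

lemma IsCondensation.integrable_comp_S2 (hP : IsCondensation P nuDisc) {f : ℝ → ℝ}
    (hf : Integrable f P) : Integrable (fun x => f (S2 x)) P :=
  (integrable_of_third_smul hP.third_map_S2_le hf).comp_measurable measurable_S2

lemma IsCondensation.integrable_nuDisc (hP : IsCondensation P nuDisc) {f : ℝ → ℝ}
    (hf : Integrable f P) : Integrable f nuDisc :=
  integrable_of_third_smul hP.third_nuDisc_le hf

lemma IsCondensation.integral_eq (hP : IsCondensation P nuDisc) {f : ℝ → ℝ}
    (hf : Integrable f P) :
    ∫ x, f x ∂P =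
      1 / 3 * ∫ x, f (S1 x) ∂P + 1 / 3 * ∫ x, f (S2 x) ∂P + 1 / 3 * ∫ x, f x ∂nuDisc := by
  have i1 := hf.mono_measure hP.third_map_S1_le
  have i2 := hf.mono_measure hP.third_map_S2_le
  have i3 := hf.mono_measure hP.third_nuDisc_le
  conv_lhs => rw [hP.2]
  rw [integral_add_measure (i1.add_measure i2) i3, integral_add_measure i1 i2,
    integral_smul_measure, integral_smul_measure, integral_smul_measure,
    integral_map measurable_S1.aemeasurable
      (integrable_of_third_smul hP.third_map_S1_le hf).aestronglyMeasurable,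
    integral_map measurable_S2.aemeasurable
      (integrable_of_third_smul hP.third_map_S2_le hf).aestronglyMeasurable]
  norm_num

lemma IsCondensation.ae_comp_S1 (hP : IsCondensation P nuDisc) {p : ℝ → Prop}
    (h : ∀ᵐ x ∂P, p x) : ∀ᵐ x ∂P, p (S1 x) := by
  have h' : ∀ᵐ x ∂((1 / 3 : ENNReal) • P.map S1), p x := ae_mono hP.third_map_S1_le h
  rw [ae_iff, Measure.smul_apply, smul_eq_mul, mul_eq_zero] at h'
  exact ae_of_ae_map measurable_S1.aemeasurable (h'.resolve_left (by simp))

lemma IsCondensation.ae_comp_S2 (hP : IsCondensation P nuDisc) {p : ℝ → Prop}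
    (h : ∀ᵐ x ∂P, p x) : ∀ᵐ x ∂P, p (S2 x) := by
  have h' : ∀ᵐ x ∂((1 / 3 : ENNReal) • P.map S2), p x := ae_mono hP.third_map_S2_le h
  rw [ae_iff, Measure.smul_apply, smul_eq_mul, mul_eq_zero] at h'
  exact ae_of_ae_map measurable_S2.aemeasurable (h'.resolve_left (by simp))

lemma IsCondensation.integral_affine_sq (hP : IsCondensation P nuDisc) (r c : ℝ) :
    ∫ x, (r * x + c) ^ 2 ∂P = r ^ 2 * ∫ x, x ^ 2 ∂P + 2 * r * c * ∫ x, x ∂P + c ^ 2 := by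
  have := hP.1
  have e : ∀ x : ℝ, (r * x + c) ^ 2 = r ^ 2 * x ^ 2 + 2 * r * c * x + c ^ 2 := fun x => by ring
  simp_rw [e]
  rw [integral_add (hP.integrable (by fun_prop)) (hP.integrable (by fun_prop)),
    integral_add (hP.integrable (by fun_prop)) (hP.integrable (by fun_prop)),
    integral_const_mul, integral_const_mul]
  simp

lemma IsCondensation.integral_id (hP : IsCondensation P nuDisc) :
    ∫ x, x ∂P = 19 / 39 := by
  have := hP.1
  have i : Integrable (fun x : ℝ => x) P := hP.integrable continuous_id
  have h := hP.integral_eq i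
  rw [integral_id_nuDisc (hP.integrable_nuDisc i)] at h
  simp only [S1, S2] at h
  rw [integral_add (hP.integrable (by fun_prop)) (hP.integrable (by fun_prop)),
    integral_div] at h
  simp at h
  linarith

lemma IsCondensation.integral_sq (hP : IsCondensation P nuDisc) :
    ∫ x, x ^ 2 ∂P = 75 / 73 * ((8 * (19 / 39) + 16) / 75 + (8 / 1575 + (7 / 15) ^ 2) / 3) := by
  have i : Integrable (fun x : ℝ => x ^ 2) P := hP.integrable (by fun_prop)
  have h := hP.integral_eq i
  have e1 : ∀ x, S1 x = 1 / 5 * x + 0 := fun x => by simp only [S1]; ring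
  have e2 : ∀ x, S2 x = 1 / 5 * x + 4 / 5 := fun x => by simp only [S2]; ring
  simp_rw [e1, e2] at h
  rw [integral_sq_nuDisc (hP.integrable_nuDisc i), hP.integral_affine_sq,
    hP.integral_affine_sq, hP.integral_id] at h
  linarith

lemma IsCondensation.distortion_eq (hP : IsCondensation P nuDisc) (α : Set ℝ) :
    distortion P α = 1 / 3 * ∫ x, infDist (S1 x) α ^ 2 ∂P + 1 / 3 * ∫ x, infDist (S2 x) α ^ 2 ∂P
      + 1 / 3 * ∫ x, infDist x α ^ 2 ∂nuDisc :=
  hP.integral_eq (hP.integrable ((continuous_infDist_pt α).pow 2))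

lemma infDist_sq_le {α : Set ℝ} {a : ℝ} (ha : a ∈ α) (x : ℝ) :
    infDist x α ^ 2 ≤ (x - a) ^ 2 := by
  rw [← sq_abs (x - a), ← Real.dist_eq]
  exact pow_le_pow_left₀ infDist_nonneg (infDist_le_dist_of_mem ha) 2

lemma IsCondensation.distortion_le (hP : IsCondensation P nuDisc) {β : Set ℝ}
    (h1 : (19 / 195 : ℝ) ∈ β) (h2 : (7 / 15 : ℝ) ∈ β) (h3 : (19 / 195 + 4 / 5 : ℝ) ∈ β) :
    distortion P β ≤ 1 / 3 * (2 / 25 * (∫ x, x ^ 2 ∂P - (19 / 39) ^ 2) + 8 / 1575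
      - 1 / 2 * (1 / 225 - infDist (2 / 5) β ^ 2)) := by
  have hc : Continuous fun x => infDist x β ^ 2 := (continuous_infDist_pt β).pow 2
  have hi := hP.integrable hc
  have hq (r c : ℝ) : Integrable (fun x => (r * x + c) ^ 2) P := hP.integrable (by fun_prop)
  rw [hP.distortion_eq]
  have b1 : ∫ x, infDist (S1 x) β ^ 2 ∂P ≤ ∫ x, (1 / 5 * x + -(19 / 195)) ^ 2 ∂P := by
    refine integral_mono (hP.integrable_comp_S1 hi) (hq _ _) fun x => ?_
    refine (infDist_sq_le h1 _).trans (le_of_eq ?_)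
    simp only [S1]; ring
  have b2 : ∫ x, infDist (S2 x) β ^ 2 ∂P ≤ ∫ x, (1 / 5 * x + -(19 / 195)) ^ 2 ∂P := by
    refine integral_mono (hP.integrable_comp_S2 hi) (hq _ _) fun x => ?_
    refine (infDist_sq_le h3 _).trans (le_of_eq ?_)
    simp only [S2]; ring
  have hν {f : ℝ → ℝ} (hf : Continuous f) : Integrable f nuDisc :=
    hP.integrable_nuDisc (hP.integrable hf)
  have hvar : ∫ x, (x - 7 / 15) ^ 2 ∂nuDisc = 8 / 1575 := by
    have hone : ∫ _x, (1 : ℝ) ∂nuDisc = 1 := by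
      have h := hP.integral_eq (hP.integrable (continuous_const (y := (1 : ℝ))))
      have := hP.1
      simp only [integral_const, probReal_univ, smul_eq_mul] at h ⊢
      linarith
    have e : ∀ x : ℝ, (x - 7 / 15) ^ 2 = x ^ 2 - 14 / 15 * x + (7 / 15) ^ 2 * 1 := fun x => by ring
    simp_rw [e]
    rw [integral_add (hν (by fun_prop)) (hν (by fun_prop)),
      integral_sub (hν (by fun_prop)) (hν (by fun_prop)), integral_const_mul, integral_const_mul,
      hone, integral_sq_nuDisc (hν (by fun_prop)), integral_id_nuDisc (hν (by fun_prop))]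
    norm_num
  have hpos : ∀ x, 0 ≤ (x - 7 / 15) ^ 2 - infDist x β ^ 2 := fun x =>
    sub_nonneg.2 (infDist_sq_le h2 x)
  have b3 := le_integral_nuDisc (f := fun x => (x - 7 / 15) ^ 2 - infDist x β ^ 2)
    (hν (by fun_prop)) fun j => hpos _
  rw [integral_sub (hν (by fun_prop)) (hν hc), hvar] at b3
  have p1 := hpos (1 / 2)
  have p2 := hpos (11 / 20)
  have p3 := hpos (23 / 40)
  rw [hP.integral_affine_sq, hP.integral_id] at b1 b2
  norm_num at *
  linarith

lemma IsOptimalSet.distortion_le {n : ℕ} {α β : Set ℝ} (h : IsOptimalSet P n α)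
    (hf : β.Finite) (hne : β.Nonempty) (hc : β.ncard ≤ n) :
    distortion P α ≤ distortion P β := by
  rw [h.2.2.2]
  refine csInf_le ⟨0, ?_⟩ ⟨β, hf, hne, hc, rfl⟩
  rintro e ⟨γ, -, -, -, rfl⟩
  exact integral_nonneg fun x => sq_nonneg _

lemma IsOptimalSet.exists_nearest {n : ℕ} {α : Set ℝ} (h : IsOptimalSet P n α) (x : ℝ) :
    ∃ y ∈ α, infDist x α = |x - y| := by
  simpa only [Real.dist_eq] using h.1.isCompact.exists_infDist_eq_dist h.2.1 x

lemma measurableSet_infDist_eq (α : Set ℝ) (a : ℝ) :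
    MeasurableSet {x | infDist x α = |x - a|} :=
  (isClosed_eq (continuous_infDist_pt α) (by fun_prop)).measurableSet

lemma IsOptimalSet.integral_cell_eq_zero {n : ℕ} {α : Set ℝ} {a : ℝ}
    (h : IsOptimalSet P n α) (hP : IsCondensation P nuDisc) (ha : a ∈ α) :
    ∫ x, {x | infDist x α = |x - a|}.indicator (fun x => x - a) x ∂P = 0 := by
  have := hP.1
  set A := {x | infDist x α = |x - a|} with hA
  set M := ∫ x, A.indicator (fun x => x - a) x ∂P with hM
  set β := insert (a + M) (α \ {a}) with hβ
  have hcard : β.ncard ≤ n := by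
    have h1 := ncard_insert_le (a + M) (α \ {a})
    have h2 := ncard_sdiff_singleton_add_one ha h.1
    have h3 := h.2.2.1
    rw [← hβ] at h1
    omega
  have hle := h.distortion_le ((h.1.sdiff).insert _) (insert_nonempty _ _) hcard
  have hi (γ : Set ℝ) : Integrable (fun x => infDist x γ ^ 2) P :=
    hP.integrable ((continuous_infDist_pt γ).pow 2)
  have hg : Integrable (A.indicator fun x => x - a) P :=
    (hP.integrable (by fun_prop)).indicator (measurableSet_infDist_eq α a)
  have hpt : ∀ x, infDist x β ^ 2 ≤
      infDist x α ^ 2 - 2 * M * A.indicator (fun x => x - a) x + M ^ 2 := by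
    intro x
    by_cases hx : x ∈ A
    · rw [indicator_of_mem hx, show infDist x α = |x - a| from hx, sq_abs]
      refine (infDist_sq_le (mem_insert _ _) x).trans (le_of_eq ?_)
      ring
    · rw [indicator_of_notMem hx]
      obtain ⟨y, hy, hxy⟩ := h.exists_nearest x
      have hya : y ≠ a := fun e => hx (by rwa [e] at hxy)
      have := infDist_sq_le (mem_insert_of_mem (a + M) (show y ∈ α \ {a} from ⟨hy, hya⟩)) x
      rw [hxy, sq_abs]
      nlinarith [sq_nonneg M]
  have hint := integral_mono (hi β)
    (((hi α).sub (hg.const_mul (2 * M))).add (integrable_const (M ^ 2))) hpt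
  rw [integral_add' ((hi α).sub (hg.const_mul (2 * M))) (integrable_const (M ^ 2)),
    integral_sub' (hi α) (hg.const_mul (2 * M)), integral_const_mul, ← hM] at hint
  simp only [integral_const, probReal_univ, smul_eq_mul, one_mul] at hint
  unfold distortion at hle
  nlinarith [sq_nonneg M]

lemma IsOptimalSet.ae_exists_nearest_mem {n : ℕ} {α : Set ℝ}
    (h : IsOptimalSet P n α) (hP : IsCondensation P nuDisc) :
    ∀ᵐ x ∂P, ∃ a ∈ α, a ∈ Icc (0 : ℝ) 1 ∧ infDist x α = |x - a| := by
  have key : ∀ᵐ x ∂P, ∀ a ∈ α, a ∉ Icc (0 : ℝ) 1 → infDist x α ≠ |x - a| := by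
    refine (ae_ball_iff h.1.countable).2 fun a ha => ?_
    by_cases hmem : a ∈ Icc (0 : ℝ) 1
    · exact Eventually.of_forall fun x hx => absurd hmem hx
    have h0 := h.integral_cell_eq_zero hP ha
    set A := {x | infDist x α = |x - a|} with hA
    have hg : Integrable (A.indicator fun x => x - a) P :=
      (hP.integrable (by fun_prop)).indicator (measurableSet_infDist_eq α a)
    have hz : ∀ᵐ x ∂P, A.indicator (fun x => x - a) x = 0 := by
      rcases lt_or_ge a 0 with hneg | hnn
      · refine (integral_eq_zero_iff_of_nonneg_ae ?_ hg).1 h0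
        filter_upwards [hP.ae_mem] with x hx
        exact indicator_apply_nonneg fun _ => by linarith [hx.1]
      · have hgt : 1 < a := lt_of_not_ge fun hle => hmem ⟨hnn, hle⟩
        have hz' := (integral_eq_zero_iff_of_nonneg_ae (f := fun x =>
          -A.indicator (fun x => x - a) x) ?_ hg.neg).1 (by rw [integral_neg, h0, neg_zero])
        · filter_upwards [hz'] with x hx
          simpa using hx
        · filter_upwards [hP.ae_mem] with x hx
          exact neg_nonneg.2 (indicator_apply_nonpos fun _ => by linarith [hx.2])
    filter_upwards [hz, hP.ae_mem] with x hx hx' _ hxA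
    rw [indicator_of_mem (show x ∈ A from hxA), sub_eq_zero] at hx
    exact hmem (hx ▸ hx')
  filter_upwards [key] with x hx
  obtain ⟨y, hy, hxy⟩ := h.exists_nearest x
  exact ⟨y, hy, by_contra fun hc => hx y hy hc hxy, hxy⟩

lemma IsOptimalSet.distortion_le_of_three_le {n : ℕ} {α : Set ℝ}
    (h : IsOptimalSet P n α) (hP : IsCondensation P nuDisc) (hn : 3 ≤ n) :
    distortion P α ≤ 1 / 3 * (2 / 25 * (∫ x, x ^ 2 ∂P - (19 / 39) ^ 2) + 8 / 1575) := by
  have hc : ({19 / 195, 7 / 15, 19 / 195 + 4 / 5} : Set ℝ).ncard ≤ n :=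
    (ncard_insert_le _ _).trans (by rw [ncard_pair (by norm_num)]; omega)
  have h1 := h.distortion_le (toFinite _) (insert_nonempty _ _) hc
  have h2 := hP.distortion_le (β := {19 / 195, 7 / 15, 19 / 195 + 4 / 5})
    (by simp) (by simp) (by simp)
  have h3 : infDist (2 / 5) ({19 / 195, 7 / 15, 19 / 195 + 4 / 5} : Set ℝ) ^ 2 ≤ _ :=
    infDist_sq_le (a := 7 / 15) (by simp) _
  norm_num at h2 h3 ⊢
  linarith

lemma IsOptimalSet.distortion_le_of_four_le {n : ℕ} {α : Set ℝ}
    (h : IsOptimalSet P n α) (hP : IsCondensation P nuDisc) (hn : 4 ≤ n) :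
    distortion P α ≤
      1 / 3 * (2 / 25 * (∫ x, x ^ 2 ∂P - (19 / 39) ^ 2) + 8 / 1575 - 1 / 450) := by
  have hc : ({2 / 5, 19 / 195, 7 / 15, 19 / 195 + 4 / 5} : Set ℝ).ncard ≤ n := by
    refine (ncard_insert_le _ _).trans ((add_le_add_left (ncard_insert_le _ _) 1).trans ?_)
    rw [ncard_pair (by norm_num)]; omega
  have h1 := h.distortion_le (toFinite _) (insert_nonempty _ _) hc
  have h2 := hP.distortion_le (β := {2 / 5, 19 / 195, 7 / 15, 19 / 195 + 4 / 5})
    (by simp) (by simp) (by simp)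
  rw [infDist_zero_of_mem (mem_insert _ _)] at h2
  norm_num at h2 ⊢
  linarith

lemma IsOptimalSet.inter_left_nonempty {n : ℕ} {α : Set ℝ}
    (h : IsOptimalSet P n α) (hP : IsCondensation P nuDisc) (hn : 3 ≤ n) :
    (α ∩ Icc (0 : ℝ) (1 / 5)).Nonempty := by
  by_contra hem
  have hlow : ∫ x, (-(1 / 5) * x + 1 / 5) ^ 2 ∂P ≤ ∫ x, infDist (S1 x) α ^ 2 ∂P := by
    refine integral_mono_ae (hP.integrable (by fun_prop))
      (hP.integrable_comp_S1 (hP.integrable ((continuous_infDist_pt α).pow 2))) ?_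
    filter_upwards [hP.ae_comp_S1 (h.ae_exists_nearest_mem hP), hP.ae_mem] with x hx hx'
    obtain ⟨a, ha, ha', hxa⟩ := hx
    have hlt : 1 / 5 < a := lt_of_not_ge fun hle => hem ⟨a, ha, ha'.1, hle⟩
    rw [hxa, sq_abs]
    simp only [S1]
    nlinarith [hx'.2]
  have hup := h.distortion_le_of_three_le hP hn
  rw [hP.distortion_eq] at hup
  have n2 : 0 ≤ ∫ x, infDist (S2 x) α ^ 2 ∂P := integral_nonneg fun x => sq_nonneg _
  have n3 : 0 ≤ ∫ x, infDist x α ^ 2 ∂nuDisc := integral_nonneg fun x => sq_nonneg _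
  rw [hP.integral_affine_sq, hP.integral_id] at hlow
  have hs := hP.integral_sq
  norm_num at hs hlow hup
  linarith

lemma IsCondensation.atoms_le_integral (hP : IsCondensation P nuDisc) {f : ℝ → ℝ}
    (hf : Continuous f) (h0 : ∀ x, 0 ≤ f x) :
    1 / 6 * f (2 / 5) + 1 / 12 * f (1 / 2) ≤ 1 / 3 * ∫ x, f x ∂nuDisc ∧
      1 / 3 * ∫ x, f x ∂nuDisc ≤ ∫ x, f x ∂P := by
  have h1 := le_integral_nuDisc (hP.integrable_nuDisc (hP.integrable hf)) fun j => h0 _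
  have h2 := hP.integral_eq (hP.integrable hf)
  have n1 : 0 ≤ ∫ x, f (S1 x) ∂P := integral_nonneg fun x => h0 _
  have n2 : 0 ≤ ∫ x, f (S2 x) ∂P := integral_nonneg fun x => h0 _
  have p2 := h0 (11 / 20)
  have p3 := h0 (23 / 40)
  constructor <;> linarith

lemma IsOptimalSet.sum_infDist_sq_ge {α : Set ℝ} (h : IsOptimalSet P 3 α) :
    1 / 200 ≤ infDist (2 / 125) α ^ 2 + infDist (22 / 125) α ^ 2
      + infDist (2 / 5) α ^ 2 + infDist (1 / 2) α ^ 2 := by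
  choose y hy hxy using h.exists_nearest
  let pts : Fin 4 → ℝ := ![2 / 125, 22 / 125, 2 / 5, 1 / 2]
  obtain ⟨i, -, j, -, hij, he⟩ := exists_ne_map_eq_of_ncard_lt_of_maps_to (s := univ) (t := α)
    (f := fun i => y (pts i))
    (by rw [ncard_univ, Nat.card_eq_fintype_card, Fintype.card_fin]; have := h.2.2.1; omega)
    (fun i _ => hy _) h.1
  have hd : (pts i - pts j) ^ 2 ≤ 2 * (infDist (pts i) α ^ 2 + infDist (pts j) α ^ 2) := by
    have he' : y (pts i) = y (pts j) := he
    rw [hxy, hxy, sq_abs, sq_abs, he']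
    nlinarith [sq_nonneg (pts i - y (pts j) + (pts j - y (pts j)))]
  have q1 := sq_nonneg (infDist (2 / 125) α)
  have q2 := sq_nonneg (infDist (22 / 125) α)
  have q3 := sq_nonneg (infDist (2 / 5) α)
  have q4 := sq_nonneg (infDist (1 / 2) α)
  fin_cases i <;> fin_cases j <;> simp [pts] at hij hd <;> norm_num at * <;> linarith

lemma IsOptimalSet.inter_right_nonempty {n : ℕ} {α : Set ℝ}
    (h : IsOptimalSet P n α) (hP : IsCondensation P nuDisc) (hn : 3 ≤ n) :
    (α ∩ Icc (4 / 5 : ℝ) 1).Nonempty := by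
  by_contra hem
  have hc : Continuous fun x => infDist x α ^ 2 := (continuous_infDist_pt α).pow 2
  have hlow : ∫ x, (1 / 5 * x + 0) ^ 2 ∂P ≤ ∫ x, infDist (S2 x) α ^ 2 ∂P := by
    refine integral_mono_ae (hP.integrable (by fun_prop))
      (hP.integrable_comp_S2 (hP.integrable hc)) ?_
    filter_upwards [hP.ae_comp_S2 (h.ae_exists_nearest_mem hP), hP.ae_mem] with x hx hx'
    obtain ⟨a, ha, ha', hxa⟩ := hx
    have hlt : a < 4 / 5 := lt_of_not_ge fun hle => hem ⟨a, ha, hle, ha'.2⟩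
    rw [hxa, sq_abs]
    simp only [S2]
    nlinarith [hx'.1]
  rw [hP.integral_affine_sq] at hlow
  have hs := hP.integral_sq
  have n1 : 0 ≤ ∫ x, infDist (S1 x) α ^ 2 ∂P := integral_nonneg fun x => sq_nonneg _
  have n3 : 0 ≤ ∫ x, infDist x α ^ 2 ∂nuDisc := integral_nonneg fun x => sq_nonneg _
  rcases hn.eq_or_lt with rfl | hn
  · have hup := h.distortion_le_of_three_le hP hn
    have hpig := h.sum_infDist_sq_ge
    have c1 : Continuous S1 := by unfold S1; fun_prop
    have c2 : Continuous S2 := by unfold S2; fun_prop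
    have hν := (hP.atoms_le_integral hc fun x => sq_nonneg _).1
    have h11 := hP.atoms_le_integral (hc.comp (c1.comp c1)) fun x => sq_nonneg _
    have h12 := hP.atoms_le_integral (hc.comp (c1.comp c2)) fun x => sq_nonneg _
    have hJ := hP.integral_eq (hP.integrable (hc.comp c1))
    have m3 : 0 ≤ ∫ x, infDist (S1 x) α ^ 2 ∂nuDisc := integral_nonneg fun x => sq_nonneg _
    have e1 : S1 (S1 (2 / 5)) = 2 / 125 := by norm_num [S1]
    have e2 : S1 (S2 (2 / 5)) = 22 / 125 := by norm_num [S1, S2]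
    simp only [Function.comp_apply, e1, e2] at h11 h12 hJ
    have q1 := sq_nonneg (infDist (S1 (S1 (1 / 2))) α)
    have q2 := sq_nonneg (infDist (S1 (S2 (1 / 2))) α)
    have q3 := sq_nonneg (infDist (2 / 5) α)
    have q4 := sq_nonneg (infDist (1 / 2) α)
    rw [hP.distortion_eq] at hup
    norm_num at *
    linarith
  · have hup := h.distortion_le_of_four_le hP hn
    rw [hP.distortion_eq] at hup
    norm_num at hs hlow hup
    linarith

lemma IsCondensation.real_eq (hP : IsCondensation P nuDisc) {s : Set ℝ} (hs : MeasurableSet s) :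
    P.real s = 1 / 3 * P.real (S1 ⁻¹' s) + 1 / 3 * P.real (S2 ⁻¹' s) + 1 / 3 * nuDisc.real s := by
  have := hP.1
  have h := hP.integral_eq ((integrable_const (1 : ℝ)).indicator hs)
  have e {g : ℝ → ℝ} (x : ℝ) : s.indicator (fun _ => (1 : ℝ)) (g x) =
      (g ⁻¹' s).indicator (fun _ => (1 : ℝ)) x := rfl
  simp_rw [e] at h
  rw [integral_indicator hs, integral_indicator hs, integral_indicator (measurable_S1 hs),
    integral_indicator (measurable_S2 hs)] at h
  simpa using h

lemma IsCondensation.real_preimage_S1_eq_zero (hP : IsCondensation P nuDisc) {s : Set ℝ}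
    (h : ∀ x ∈ Icc (0 : ℝ) (1 / 5), x ∉ s) : P.real (S1 ⁻¹' s) = 0 := by
  have h0 : P (S1 ⁻¹' s) = 0 := by
    refine measure_eq_zero_iff_ae_notMem.2 ?_
    filter_upwards [hP.ae_mem] with x hx
    refine h (S1 x) ?_
    simp only [S1, mem_Icc] at *
    constructor <;> linarith
  simp [Measure.real, h0]

lemma IsCondensation.real_preimage_S2_eq_zero (hP : IsCondensation P nuDisc) {s : Set ℝ}
    (h : ∀ x ∈ Icc (4 / 5 : ℝ) 1, x ∉ s) : P.real (S2 ⁻¹' s) = 0 := by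
  have h0 : P (S2 ⁻¹' s) = 0 := by
    refine measure_eq_zero_iff_ae_notMem.2 ?_
    filter_upwards [hP.ae_mem] with x hx
    refine h (S2 x) ?_
    simp only [S2, mem_Icc] at *
    constructor <;> linarith
  simp [Measure.real, h0]

lemma nuDisc_real_eq_zero {s : Set ℝ} (h : ∀ x ∈ Icc (2 / 5 : ℝ) (3 / 5), x ∉ s) :
    nuDisc.real s = 0 := by
  have h0 : nuDisc s = 0 := measure_eq_zero_iff_ae_notMem.2 (ae_nuDisc fun j => h _ (aseq_mem j))
  simp [Measure.real, h0]

lemma IsCondensation.nuDisc_real_le_one (hP : IsCondensation P nuDisc) (s : Set ℝ) :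
    nuDisc.real s ≤ 1 := by
  have := hP.1
  have h := hP.real_eq MeasurableSet.univ
  simp only [preimage_univ, probReal_univ] at h
  have hfin : nuDisc univ ≠ ⊤ := fun e => by
    rw [Measure.real, e] at h
    norm_num at h
  have := measureReal_mono (subset_univ s) hfin
  linarith

lemma IsCondensation.real_Ici_le (hP : IsCondensation P nuDisc) {τ : ℝ} (hτ : 3 / 5 < τ) :
    P.real (Ici τ) ≤ 1 / 3 * P.real (Ici (5 * τ - 4)) := by
  rw [hP.real_eq measurableSet_Ici,
    hP.real_preimage_S1_eq_zero fun x hx hx' => by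
      have := hx.2; have := mem_Ici.1 hx'; linarith,
    nuDisc_real_eq_zero fun x hx hx' => by have := hx.2; have := mem_Ici.1 hx'; linarith,
    show S2 ⁻¹' Ici τ = Ici (5 * τ - 4) by
      ext x; simp only [S2, mem_preimage, mem_Ici]; constructor <;> intro <;> linarith]
  linarith

lemma IsCondensation.real_Ici_le_two_thirds (hP : IsCondensation P nuDisc) {τ : ℝ}
    (hτ : 1 / 5 < τ) : P.real (Ici τ) ≤ 2 / 3 := by
  have := hP.1
  rw [hP.real_eq measurableSet_Ici,
    hP.real_preimage_S1_eq_zero fun x hx hx' => by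
      have := hx.2; have := mem_Ici.1 hx'; linarith]
  have h1 := hP.nuDisc_real_le_one (Ici τ)
  have h2 : P.real (S2 ⁻¹' Ici τ) ≤ 1 := measureReal_le_one
  linarith

lemma IsCondensation.real_Iic_le (hP : IsCondensation P nuDisc) {τ : ℝ} (hτ : τ < 2 / 5) :
    P.real (Iic τ) ≤ 1 / 3 * P.real (Iic (5 * τ)) := by
  rw [hP.real_eq measurableSet_Iic,
    hP.real_preimage_S2_eq_zero fun x hx hx' => by
      have := hx.1; have := mem_Iic.1 hx'; linarith,
    nuDisc_real_eq_zero fun x hx hx' => by have := hx.1; have := mem_Iic.1 hx'; linarith,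
    show S1 ⁻¹' Iic τ = Iic (5 * τ) by
      ext x; simp only [S1, mem_preimage, mem_Iic]; constructor <;> intro <;> linarith]
  linarith

lemma IsCondensation.real_Iic_le_two_thirds (hP : IsCondensation P nuDisc) {τ : ℝ}
    (hτ : τ < 4 / 5) : P.real (Iic τ) ≤ 2 / 3 := by
  have := hP.1
  rw [hP.real_eq measurableSet_Iic,
    hP.real_preimage_S2_eq_zero fun x hx hx' => by
      have := hx.1; have := mem_Iic.1 hx'; linarith]
  have h1 := hP.nuDisc_real_le_one (Iic τ)
  have h2 : P.real (S1 ⁻¹' Iic τ) ≤ 1 := measureReal_le_one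
  linarith

lemma IsOptimalSet.infDist_half_ne {n : ℕ} {α : Set ℝ} {a p : ℝ}
    (h : IsOptimalSet P n α) (hP : IsCondensation P nuDisc) (ha : a ∈ α)
    (ha' : a ∈ Ioo (1 / 5 : ℝ) (2 / 5)) (hp : p ∈ α) (hp' : p ∈ Icc (0 : ℝ) (1 / 5))
    (h25 : infDist (2 / 5) α = |2 / 5 - a|) : infDist (1 / 2) α ≠ |1 / 2 - a| := by
  intro h12
  have := hP.1
  obtain ⟨ha1, ha2⟩ := ha'
  have le_one (s : Set ℝ) : P.real s ≤ 1 := measureReal_le_one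
  set A := {x | infDist x α = |x - a|}
  set g := A.indicator fun x => x - a
  have h0 : ∫ x, g x ∂P = 0 := h.integral_cell_eq_zero hP ha
  have hg : Integrable g P :=
    (hP.integrable (by fun_prop)).indicator (measurableSet_infDist_eq α a)
  have hnn : ∀ x, a ≤ x → 0 ≤ g x := fun x hx => indicator_apply_nonneg fun _ => sub_nonneg.2 hx
  rw [hP.integral_eq hg] at h0
  have hν := le_integral_nuDisc (hP.integrable_nuDisc hg)
    fun j => hnn _ (ha2.le.trans (aseq_mem j).1)
  have e1 : g (2 / 5) = 2 / 5 - a := indicator_of_mem (s := A) h25 _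
  have e2 : g (1 / 2) = 1 / 2 - a := indicator_of_mem (s := A) h12 _
  have p2 := hnn (11 / 20) (by linarith)
  have p3 := hnn (23 / 40) (by linarith)
  have hS2 : 0 ≤ ∫ x, g (S2 x) ∂P := by
    refine integral_nonneg_of_ae ?_
    filter_upwards [hP.ae_mem] with x hx
    refine hnn _ ?_
    simp only [S2]
    linarith [hx.1]
  have hS1 : -(a / 2) * P.real (Ici (5 / 2 * a)) ≤ ∫ x, g (S1 x) ∂P := by
    have hle : ∫ x, (Ici (5 / 2 * a)).indicator (fun _ => -(a / 2)) x ∂P ≤ ∫ x, g (S1 x) ∂P := by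
      refine integral_mono_ae ((integrable_const _).indicator measurableSet_Ici)
        (hP.integrable_comp_S1 hg) ?_
      filter_upwards [hP.ae_mem] with x hx
      by_cases hxA : infDist (S1 x) α = |S1 x - a|
      · have hgx : g (S1 x) = S1 x - a := indicator_of_mem (s := A) hxA _
        have hle : |S1 x - a| ≤ |S1 x - p| := by
          rw [← hxA, ← Real.dist_eq]
          exact infDist_le_dist_of_mem hp
        have hxa : x / 5 - a ≤ 0 := by linarith [hx.2]
        simp only [S1] at hle hgx ⊢
        rw [abs_of_nonpos hxa, le_abs] at hle
        have hge : 5 / 2 * a ≤ x := by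
          rcases hle with hle | hle <;> linarith [hp'.1, hp'.2]
        rw [indicator_of_mem (mem_Ici.2 hge), hgx]
        linarith
      · have hgx : g (S1 x) = 0 := indicator_of_notMem (s := A) hxA _
        rw [hgx]
        exact indicator_apply_nonpos fun _ => by linarith
    rwa [integral_indicator_const _ measurableSet_Ici, smul_eq_mul, mul_comm] at hle
  have main : 1 / 2 * (2 / 5 - a) + 1 / 4 * (1 / 2 - a) ≤ a / 2 * P.real (Ici (5 / 2 * a)) := by
    rw [e1, e2] at hν
    linarith
  have bound {c : ℝ} (hc : P.real (Ici (5 / 2 * a)) ≤ c) :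
      1 / 2 * (2 / 5 - a) + 1 / 4 * (1 / 2 - a) ≤ a / 2 * c :=
    main.trans (mul_le_mul_of_nonneg_left hc (by linarith))
  have s1 := bound (le_one _)
  have g2 := hP.real_Ici_le (τ := 5 / 2 * a) (by linarith)
  have s2 := bound (c := 1 / 3) (g2.trans (by linarith [le_one (Ici (5 * (5 / 2 * a) - 4))]))
  have g3 := hP.real_Ici_le_two_thirds (τ := 5 * (5 / 2 * a) - 4) (by linarith)
  have s3 := bound (c := 2 / 9) (by linarith)
  have g4 := hP.real_Ici_le (τ := 5 * (5 / 2 * a) - 4) (by linarith)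
  have s4 := bound (c := 1 / 9) (by linarith [le_one (Ici (5 * (5 * (5 / 2 * a) - 4) - 4))])
  linarith

lemma IsOptimalSet.exists_infDist_ne {n : ℕ} {α : Set ℝ} {b q : ℝ}
    (h : IsOptimalSet P n α) (hP : IsCondensation P nuDisc) (hb : b ∈ α)
    (hb' : b ∈ Ioo (3 / 5 : ℝ) (4 / 5)) (hq : q ∈ α) (hq' : q ∈ Icc (4 / 5 : ℝ) 1) :
    ∃ x ∈ Icc (1 / 2 : ℝ) (3 / 5), infDist x α ≠ |x - b| := by
  by_contra! hall
  have := hP.1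
  obtain ⟨hb1, hb2⟩ := hb'
  have le_one (s : Set ℝ) : P.real s ≤ 1 := measureReal_le_one
  set A := {x | infDist x α = |x - b|}
  set g := A.indicator fun x => x - b
  have h0 : ∫ x, g x ∂P = 0 := h.integral_cell_eq_zero hP hb
  have hg : Integrable g P :=
    (hP.integrable (by fun_prop)).indicator (measurableSet_infDist_eq α b)
  have hnp : ∀ x, x ≤ b → g x ≤ 0 := fun x hx => indicator_apply_nonpos fun _ => sub_nonpos.2 hx
  rw [hP.integral_eq hg] at h0
  have hν := le_integral_nuDisc (hP.integrable_nuDisc hg).neg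
    fun j => neg_nonneg.2 (hnp _ ((aseq_mem j).2.trans hb1.le))
  have hev (x : ℝ) (hx : x ∈ Icc (1 / 2 : ℝ) (3 / 5)) : g x = x - b :=
    indicator_of_mem (s := A) (hall x hx) _
  have p1 := hnp (2 / 5) (by linarith)
  have hS1 : ∫ x, g (S1 x) ∂P ≤ 0 := by
    refine integral_nonpos_of_ae ?_
    filter_upwards [hP.ae_mem] with x hx
    refine hnp _ ?_
    simp only [S1]
    linarith [hx.2]
  have hS2 : ∫ x, g (S2 x) ∂P ≤ (1 - b) / 2 * P.real (Iic ((5 * b - 3) / 2)) := by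
    have hle : ∫ x, g (S2 x) ∂P ≤
        ∫ x, (Iic ((5 * b - 3) / 2)).indicator (fun _ => (1 - b) / 2) x ∂P := by
      refine integral_mono_ae (hP.integrable_comp_S2 hg)
        ((integrable_const _).indicator measurableSet_Iic) ?_
      filter_upwards [hP.ae_mem] with x hx
      by_cases hxA : infDist (S2 x) α = |S2 x - b|
      · have hgx : g (S2 x) = S2 x - b := indicator_of_mem (s := A) hxA _
        have hle : |S2 x - b| ≤ |S2 x - q| := by
          rw [← hxA, ← Real.dist_eq]
          exact infDist_le_dist_of_mem hq
        have hxb : 0 ≤ x / 5 + 4 / 5 - b := by linarith [hx.1]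
        simp only [S2] at hle hgx ⊢
        rw [abs_of_nonneg hxb, le_abs] at hle
        have hge : x ≤ (5 * b - 3) / 2 := by
          rcases hle with hle | hle <;> linarith [hq'.1, hq'.2]
        rw [indicator_of_mem (mem_Iic.2 hge), hgx]
        linarith
      · have hgx : g (S2 x) = 0 := indicator_of_notMem (s := A) hxA _
        rw [hgx]
        exact indicator_apply_nonneg fun _ => by linarith
    rwa [integral_indicator_const _ measurableSet_Iic, smul_eq_mul, mul_comm] at hle
  have main : 1 / 4 * (b - 1 / 2) + 1 / 8 * (b - 11 / 20) + 1 / 16 * (b - 23 / 40) ≤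
      (1 - b) / 2 * P.real (Iic ((5 * b - 3) / 2)) := by
    simp only [Pi.neg_apply, integral_neg] at hν
    rw [hev (1 / 2) (by norm_num), hev (11 / 20) (by norm_num),
      hev (23 / 40) (by norm_num)] at hν
    linarith
  have bound {c : ℝ} (hc : P.real (Iic ((5 * b - 3) / 2)) ≤ c) :
      1 / 4 * (b - 1 / 2) + 1 / 8 * (b - 11 / 20) + 1 / 16 * (b - 23 / 40) ≤ (1 - b) / 2 * c :=
    main.trans (mul_le_mul_of_nonneg_left hc (by linarith))
  have s1 := bound (le_one _)
  have s2 := bound (hP.real_Iic_le_two_thirds (by linarith))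
  have g3 := hP.real_Iic_le (τ := (5 * b - 3) / 2) (by linarith)
  have s3 := bound (c := 1 / 3) (g3.trans (by linarith [le_one (Iic (5 * ((5 * b - 3) / 2)))]))
  have g4 := hP.real_Iic_le_two_thirds (τ := 5 * ((5 * b - 3) / 2)) (by linarith)
  have s4 := bound (c := 2 / 9) (by linarith)
  have g5 := hP.real_Iic_le (τ := 5 * ((5 * b - 3) / 2)) (by linarith)
  have s5 := bound (c := 1 / 9) (by linarith [le_one (Iic (5 * (5 * ((5 * b - 3) / 2))))])
  linarith

lemma IsOptimalSet.inter_middle_nonempty {n : ℕ} {α : Set ℝ}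
    (h : IsOptimalSet P n α) (hP : IsCondensation P nuDisc) (hn : 3 ≤ n) :
    (α ∩ Icc (2 / 5 : ℝ) (3 / 5)).Nonempty := by
  by_contra hem
  obtain ⟨p, hp, hp'⟩ := h.inter_left_nonempty hP hn
  obtain ⟨q, hq, hq'⟩ := h.inter_right_nonempty hP hn
  have hout : ∀ y ∈ α, y < 2 / 5 ∨ 3 / 5 < y := fun y hy => by
    by_contra! hc
    exact hem ⟨y, hy, hc.1, hc.2⟩
  obtain ⟨a, ha, h25⟩ := h.exists_nearest (2 / 5)
  obtain ⟨w, hw, h12⟩ := h.exists_nearest (1 / 2)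
  have hle25 {y : ℝ} (hy : y ∈ α) : |2 / 5 - a| ≤ |2 / 5 - y| := by
    rw [← h25, ← Real.dist_eq]; exact infDist_le_dist_of_mem hy
  have hle12 {y : ℝ} (hy : y ∈ α) : |1 / 2 - w| ≤ |1 / 2 - y| := by
    rw [← h12, ← Real.dist_eq]; exact infDist_le_dist_of_mem hy
  have hsmall : |2 / 5 - a| < 1 / 5 := by
    have hup := h.distortion_le_of_three_le hP hn
    have hs := hP.integral_sq
    have hat := hP.atoms_le_integral ((continuous_infDist_pt α).pow 2) fun x => sq_nonneg _
    have hsq := sq_nonneg (infDist (1 / 2) α)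
    simp only [Pi.pow_apply, h25] at hat
    unfold distortion at hup
    rw [hs] at hup
    refine lt_of_pow_lt_pow_left₀ 2 (by norm_num) ?_
    norm_num at *
    linarith
  rw [abs_lt] at hsmall
  have ha2 : a < 2 / 5 := (hout a ha).resolve_right (by linarith)
  have ha' : a ∈ Ioo (1 / 5 : ℝ) (2 / 5) := ⟨by linarith, ha2⟩
  have hne := h.infDist_half_ne hP ha ha' hp hp' h25
  have hwa := hle12 ha
  rw [abs_of_pos (by linarith : 0 < 1 / 2 - a)] at hwa hne
  rcases hout w hw with hw2 | hw2
  · have haw := hle25 hw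
    rw [abs_of_pos (by linarith), abs_of_pos (by linarith)] at haw
    rw [abs_of_pos (by linarith)] at hwa h12
    exact hne (by linarith)
  · rw [abs_of_neg (by linarith)] at hwa
    obtain ⟨x, hx, hxw⟩ := h.exists_infDist_ne hP hw ⟨hw2, by linarith⟩ hq hq'
    obtain ⟨y, hy, hxy⟩ := h.exists_nearest x
    refine hxw (le_antisymm ?_ ?_)
    · rw [← Real.dist_eq]; exact infDist_le_dist_of_mem hw
    · have hwy := hle12 hy
      rw [hxy, abs_of_nonpos (by linarith [hx.2])]
      rw [abs_of_neg (by linarith)] at hwy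
      rcases hout y hy with hy2 | hy2
      · rw [abs_of_pos (by linarith)] at hwy
        rw [abs_of_pos (by linarith [hx.1])]
        linarith [hx.1]
      · rw [abs_of_neg (by linarith)] at hwy
        rw [abs_of_nonpos (by linarith [hx.2])]
        linarith

end Condensation

theorem optimal_sets_meet_pieces_discrete (P : MeasureTheory.Measure ℝ)
    (hP : IsCondensation P nuDisc) :
    ∀ n : ℕ, 3 ≤ n → ∀ α : Set ℝ, IsOptimalSet P n α →
      (α ∩ Set.Icc (0 : ℝ) (1 / 5)).Nonempty ∧
      (α ∩ Set.Icc (4 / 5 : ℝ) 1).Nonempty ∧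
      (α ∩ Set.Icc (2 / 5 : ℝ) (3 / 5)).Nonempty :=
  fun _ hn _ hα => ⟨hα.inter_left_nonempty hP hn, hα.inter_right_nonempty hP hn,
    hα.inter_middle_nonempty hP hn⟩
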